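/- arXiv:1305.6746 — 3 statements merged into one kernel-verified Lean document; each statement's English description precedes it below -/
import Mathlib

section
/- For every b ∈ ℝ, μ > 0 and k ∈ ℤ, the set E_k^{b,μ} = { a ∈ ℝ : ρ_{a,b,μ} = k } is a nonempty compact interval, i.e., E_k^{b,μ} = [a⁻, a⁺] for some real numbers a⁻ ≤ a⁺. -/
open Real Filter

/-- `x` is a (global) solution of the Josephson equation `dx/dt = (cos x + a + b cos t)/μ`. -/
def IsJosephsonSol (a b μ : ℝ) (x : ℝ → ℝ) : Prop :=
  ∀ t : ℝ, HasDerivAt x ((Real.cos (x t) + a + b * Real.cos t) / μ) t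

/-- `P` is the Poincaré lift of the Josephson equation. -/
def IsPoincareLift (a b μ : ℝ) (P : ℝ → ℝ) : Prop :=
  ∀ x₀ : ℝ, ∃ x : ℝ → ℝ, IsJosephsonSol a b μ x ∧ x 0 = x₀ ∧ P x₀ = x (2 * π)

/-- `ρ` is the rotation number of the lift `P`. -/
def IsRotNumber (P : ℝ → ℝ) (ρ : ℝ) : Prop :=
  ∀ x₀ : ℝ, Tendsto (fun n : ℕ => (P^[n] x₀ - x₀) / (2 * π * n)) atTop (nhds ρ)

namespace IsJosephsonSol

variable {a a' b μ ε : ℝ} {x y : ℝ → ℝ}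

theorem le_add_of_pos (hμ : 0 < μ) (hx : IsJosephsonSol a b μ x) (hy : IsJosephsonSol a' b μ y)
    (hε : 0 < ε) (h₀ : x 0 ≤ y 0 + ε) (ha : a ≤ a' + ε) {t : ℝ} (ht : 0 ≤ t) :
    x t ≤ y t + ε * exp ((2 / μ + 1) * t) := by
  refine image_le_of_deriv_right_lt_deriv_boundary
    (f' := fun t => (cos (x t) + a + b * cos t) / μ)
    (B := fun t => y t + ε * exp ((2 / μ + 1) * t))
    (B' := fun t => (cos (y t) + a' + b * cos t) / μ
      + ε * (exp ((2 / μ + 1) * t) * (2 / μ + 1)))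
    (fun s _ => (hx s).continuousAt.continuousWithinAt)
    (fun s _ => (hx s).hasDerivWithinAt) (by simpa using h₀)
    (fun s => (hy s).add ?_) ?_ (Set.right_mem_Icc.2 ht)
  · have := ((hasDerivAt_id s).const_mul (2 / μ + 1)).exp.const_mul ε
    simpa using this
  · intro s hs hxy
    have he : 1 ≤ exp ((2 / μ + 1) * s) := one_le_exp (by have := hs.1; positivity)
    have hcos := (abs_le.1 (abs_cos_sub_cos_le (x s) (y s))).2
    have habs : |x s - y s| = ε * exp ((2 / μ + 1) * s) := by
      rw [hxy, add_sub_cancel_left, abs_of_pos (by positivity)]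
    rw [habs] at hcos
    set E := exp ((2 / μ + 1) * s)
    have hE : ε ≤ ε * E := le_mul_of_one_le_right hε.le he
    have hsplit : (cos (y s) + a' + b * cos s) / μ + ε * (E * (2 / μ + 1))
        = (cos (y s) + a' + b * cos s + 2 * (ε * E)) / μ + ε * E := by
      field_simp
      ring
    rw [hsplit]
    have : (cos (x s) + a + b * cos s) / μ ≤ (cos (y s) + a' + b * cos s + 2 * (ε * E)) / μ :=
      div_le_div_of_nonneg_right (by linarith) hμ.le
    linarith

theorem le_add (hμ : 0 < μ) (hx : IsJosephsonSol a b μ x) (hy : IsJosephsonSol a' b μ y)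
    (hε : 0 ≤ ε) (h₀ : x 0 ≤ y 0 + ε) (ha : a ≤ a' + ε) {t : ℝ} (ht : 0 ≤ t) :
    x t ≤ y t + ε * exp ((2 / μ + 1) * t) := by
  refine le_of_forall_pos_le_add fun η hη => ?_
  have hpos := div_pos hη (exp_pos ((2 / μ + 1) * t))
  have h := hx.le_add_of_pos hμ hy (ε := ε + η / exp ((2 / μ + 1) * t)) (by positivity)
    (by linarith) (by linarith) ht
  rwa [add_mul, div_mul_cancel₀ _ (exp_pos _).ne', ← add_assoc] at h

theorem le_of_le (hμ : 0 < μ) (hx : IsJosephsonSol a b μ x) (hy : IsJosephsonSol a' b μ y)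
    (h₀ : x 0 ≤ y 0) (ha : a ≤ a') {t : ℝ} (ht : 0 ≤ t) : x t ≤ y t := by
  simpa using hx.le_add hμ hy le_rfl (by simpa using h₀) (by simpa using ha) ht

theorem add_two_pi (hx : IsJosephsonSol a b μ x) : IsJosephsonSol a b μ fun t => x t + 2 * π := by
  intro t
  simpa using (hx t).add_const (2 * π)

theorem le_sub (hμ : 0 < μ) (hx : IsJosephsonSol a b μ x) {t : ℝ} (ht : 0 ≤ t) :
    (a - 1 - |b|) / μ * t ≤ x t - x 0 := by
  have h := mul_sub_le_image_sub_of_le_deriv (C := (a - 1 - |b|) / μ)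
    (fun s => (hx s).differentiableAt) (fun s => ?_) ht
  · simpa using h
  · rw [(hx s).deriv]
    refine div_le_div_of_nonneg_right ?_ hμ.le
    have hbc : |b * cos s| ≤ |b| := by
      rw [abs_mul]
      exact mul_le_of_le_one_right (abs_nonneg b) (abs_cos_le_one s)
    linarith [neg_one_le_cos (x s), neg_le_of_abs_le hbc]

theorem sub_le (hμ : 0 < μ) (hx : IsJosephsonSol a b μ x) {t : ℝ} (ht : 0 ≤ t) :
    x t - x 0 ≤ (a + 1 + |b|) / μ * t := by
  have h := image_sub_le_mul_sub_of_deriv_le (C := (a + 1 + |b|) / μ)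
    (fun s => (hx s).differentiableAt) (fun s => ?_) ht
  · simpa using h
  · rw [(hx s).deriv]
    refine div_le_div_of_nonneg_right ?_ hμ.le
    have hbc : |b * cos s| ≤ |b| := by
      rw [abs_mul]
      exact mul_le_of_le_one_right (abs_nonneg b) (abs_cos_le_one s)
    linarith [cos_le_one (x s), le_of_abs_le hbc]

end IsJosephsonSol

namespace IsPoincareLift

variable {a a' b μ : ℝ} {P P' : ℝ → ℝ}

theorem le_add (hμ : 0 < μ) (hP : IsPoincareLift a b μ P) (hP' : IsPoincareLift a' b μ P')
    {ε x y : ℝ} (hε : 0 ≤ ε) (h₀ : x ≤ y + ε) (ha : a ≤ a' + ε) :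
    P x ≤ P' y + exp ((2 / μ + 1) * (2 * π)) * ε := by
  obtain ⟨u, hu, hu0, hPu⟩ := hP x
  obtain ⟨v, hv, hv0, hPv⟩ := hP' y
  rw [hPu, hPv, mul_comm _ ε]
  exact hu.le_add hμ hv hε (by rwa [hu0, hv0]) ha two_pi_pos.le

theorem le_of_le (hμ : 0 < μ) (hP : IsPoincareLift a b μ P) (hP' : IsPoincareLift a' b μ P')
    {x y : ℝ} (h₀ : x ≤ y) (ha : a ≤ a') : P x ≤ P' y := by
  simpa using hP.le_add hμ hP' le_rfl (by simpa using h₀) (by simpa using ha)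

theorem map_add_two_pi (hμ : 0 < μ) (hP : IsPoincareLift a b μ P) (x : ℝ) :
    P (x + 2 * π) = P x + 2 * π := by
  obtain ⟨u, hu, hu0, hPu⟩ := hP x
  obtain ⟨v, hv, hv0, hPv⟩ := hP (x + 2 * π)
  rw [hPu, hPv]
  have h₀ : v 0 = u 0 + 2 * π := by rw [hu0, hv0]
  exact le_antisymm (hv.le_of_le hμ hu.add_two_pi h₀.le le_rfl two_pi_pos.le)
    (hu.add_two_pi.le_of_le hμ hv h₀.ge le_rfl two_pi_pos.le)

theorem le_sub (hμ : 0 < μ) (hP : IsPoincareLift a b μ P) (x : ℝ) :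
    (a - 1 - |b|) / μ * (2 * π) ≤ P x - x := by
  obtain ⟨u, hu, rfl, hPu⟩ := hP x
  exact hPu ▸ hu.le_sub hμ two_pi_pos.le

theorem sub_le (hμ : 0 < μ) (hP : IsPoincareLift a b μ P) (x : ℝ) :
    P x - x ≤ (a + 1 + |b|) / μ * (2 * π) := by
  obtain ⟨u, hu, rfl, hPu⟩ := hP x
  exact hPu ▸ hu.sub_le hμ two_pi_pos.le

/-- The Poincaré lift, rescaled to a degree one lift of a circle map of period one. -/
noncomputable def circleLift (hμ : 0 < μ) (hP : IsPoincareLift a b μ P) : CircleDeg1Lift where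
  toFun x := P (2 * π * x) / (2 * π)
  monotone' x y hxy := div_le_div_of_nonneg_right
    (hP.le_of_le hμ hP (mul_le_mul_of_nonneg_left hxy two_pi_pos.le) le_rfl) two_pi_pos.le
  map_add_one' x := by
    rw [mul_add, mul_one, hP.map_add_two_pi hμ, add_div, div_self two_pi_pos.ne']

theorem circleLift_apply (hμ : 0 < μ) (hP : IsPoincareLift a b μ P) (x : ℝ) :
    hP.circleLift hμ x = P (2 * π * x) / (2 * π) := rfl

theorem circleLift_iterate (hμ : 0 < μ) (hP : IsPoincareLift a b μ P) (n : ℕ) (x : ℝ) :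
    2 * π * (hP.circleLift hμ)^[n] x = P^[n] (2 * π * x) := by
  have h : Function.Semiconj (fun x => 2 * π * x) (hP.circleLift hμ) P := fun x => by
    simp only [circleLift_apply]
    field_simp
  exact h.iterate_right n x

theorem translationNumber_circleLift (hμ : 0 < μ) (hP : IsPoincareLift a b μ P) {r : ℝ}
    (hr : IsRotNumber P r) : (hP.circleLift hμ).translationNumber = r := by
  refine tendsto_nhds_unique ((hP.circleLift hμ).tendsto_translationNumber 0)
    ((hr 0).congr fun n => ?_)
  have h := hP.circleLift_iterate hμ n 0
  rw [mul_zero] at h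
  rw [CircleDeg1Lift.coe_pow, ← h, sub_zero, sub_zero, mul_div_mul_left _ _ two_pi_pos.ne']

theorem continuous_uncurry {b μ : ℝ} (hμ : 0 < μ) {P : ℝ → ℝ → ℝ}
    (hP : ∀ a, IsPoincareLift a b μ (P a)) : Continuous (Function.uncurry P) := by
  refine (LipschitzWith.of_le_add_mul ⟨exp ((2 / μ + 1) * (2 * π)), (exp_pos _).le⟩
    fun p q => ?_).continuous
  refine (hP p.1).le_add hμ (hP q.1) dist_nonneg ?_ ?_
  · have h : dist p.2 q.2 ≤ dist p q := le_max_right _ _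
    linarith [le_of_abs_le (Real.dist_eq p.2 q.2 ▸ h)]
  · have h : dist p.1 q.1 ≤ dist p q := le_max_left _ _
    linarith [le_of_abs_le (Real.dist_eq p.1 q.1 ▸ h)]

theorem rotNumber_le_of_le (hμ : 0 < μ) (hP : IsPoincareLift a b μ P)
    (hP' : IsPoincareLift a' b μ P') {r r' : ℝ} (hr : IsRotNumber P r) (hr' : IsRotNumber P' r')
    (ha : a ≤ a') : r ≤ r' := by
  rw [← hP.translationNumber_circleLift hμ hr, ← hP'.translationNumber_circleLift hμ hr']
  exact CircleDeg1Lift.translationNumber_mono fun x =>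
    div_le_div_of_nonneg_right (hP.le_of_le hμ hP' le_rfl ha) two_pi_pos.le

theorem rotNumber_eq_int_iff (hμ : 0 < μ) (hP : IsPoincareLift a b μ P) (hc : Continuous P)
    {r : ℝ} (hr : IsRotNumber P r) (k : ℤ) :
    r = k ↔ ∃ x ∈ Set.Icc 0 1, P (2 * π * x) = 2 * π * x + 2 * π * k := by
  have key (x : ℝ) : hP.circleLift hμ x = x + k ↔ P (2 * π * x) = 2 * π * x + 2 * π * k := by
    rw [circleLift_apply, div_eq_iff two_pi_pos.ne', ← mul_add, mul_comm (2 * π) (x + k)]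
  have hcont : Continuous (hP.circleLift hμ) := by
    change Continuous fun x => P (2 * π * x) / (2 * π)
    fun_prop
  rw [← hP.translationNumber_circleLift hμ hr, CircleDeg1Lift.translationNumber_eq_int_iff _ hcont]
  constructor
  · rintro ⟨x, hx⟩
    refine ⟨Int.fract x, ⟨Int.fract_nonneg x, (Int.fract_lt_one x).le⟩, (key _).1 ?_⟩
    linarith [(hP.circleLift hμ).map_fract_sub_fract_eq x]
  · rintro ⟨x, -, hx⟩
    exact ⟨x, (key x).2 hx⟩

theorem mem_Icc_of_map_eq (hμ : 0 < μ) (hP : IsPoincareLift a b μ P) {x k : ℝ}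
    (hx : P x = x + 2 * π * k) : a ∈ Set.Icc (μ * k - 1 - |b|) (μ * k + 1 + |b|) := by
  have h₁ := hP.le_sub hμ x
  have h₂ := hP.sub_le hμ x
  rw [hx, add_sub_cancel_left, mul_comm (2 * π) k] at h₁ h₂
  have h₁ := (div_le_iff₀ hμ).1 (le_of_mul_le_mul_right h₁ two_pi_pos)
  have h₂ := (le_div_iff₀ hμ).1 (le_of_mul_le_mul_right h₂ two_pi_pos)
  constructor <;> linarith

theorem exists_map_zero_eq {b μ : ℝ} (hμ : 0 < μ) {P : ℝ → ℝ → ℝ}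
    (hP : ∀ a, IsPoincareLift a b μ (P a)) (k : ℝ) : ∃ a, P a 0 = 2 * π * k := by
  have hc : Continuous fun a => P a 0 :=
    (continuous_uncurry hμ hP).comp (by fun_prop : Continuous fun a : ℝ => (a, (0 : ℝ)))
  refine mem_range_of_exists_le_of_exists_ge hc ⟨μ * k - 1 - |b|, ?_⟩ ⟨μ * k + 1 + |b|, ?_⟩
  · have h := (hP (μ * k - 1 - |b|)).sub_le hμ 0
    rw [show μ * k - 1 - |b| + 1 + |b| = μ * k by ring, mul_div_cancel_left₀ _ hμ.ne'] at h
    linarith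
  · have h := (hP (μ * k + 1 + |b|)).le_sub hμ 0
    rw [show μ * k + 1 + |b| - 1 - |b| = μ * k by ring, mul_div_cancel_left₀ _ hμ.ne'] at h
    linarith

end IsPoincareLift

/-- For every `b`, `μ > 0` and integer `k`, the section
`E_k^{b,μ} = {a : ρ_{a,b,μ} = k}` of the `k`-th Arnold tongue is a nonempty compact
interval `[a⁻, a⁺]`. -/
theorem tongue_section_is_interval
    (b μ : ℝ) (hμ : 0 < μ) (k : ℤ)
    (P : ℝ → ℝ → ℝ) (ρ : ℝ → ℝ)
    (hP : ∀ a : ℝ, IsPoincareLift a b μ (P a))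
    (hρ : ∀ a : ℝ, IsRotNumber (P a) (ρ a)) :
    ∃ aminus aplus : ℝ, aminus ≤ aplus ∧
      {a : ℝ | ρ a = (k : ℝ)} = Set.Icc aminus aplus := by
  have hc := IsPoincareLift.continuous_uncurry hμ hP
  have hca (a : ℝ) : Continuous (P a) := hc.comp (by fun_prop : Continuous fun x : ℝ => (a, x))
  have hmono : Monotone ρ := fun a a' h =>
    (hP a).rotNumber_le_of_le hμ (hP a') (hρ a) (hρ a') h
  have hiff (a : ℝ) := (hP a).rotNumber_eq_int_iff hμ (hca a) (hρ a) k
  have hne : {a : ℝ | ρ a = k}.Nonempty := by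
    obtain ⟨a, ha⟩ := IsPoincareLift.exists_map_zero_eq hμ hP k
    exact ⟨a, (hiff a).2 ⟨0, by simp, by simpa using ha⟩⟩
  have hconn : {a : ℝ | ρ a = k}.OrdConnected :=
    ⟨fun x hx y hy z hz => le_antisymm ((hmono hz.2).trans_eq hy) (hx.ge.trans (hmono hz.1))⟩
  have hcompact : IsCompact {a : ℝ | ρ a = k} := by
    have hclosed : IsClosed {p : ℝ × ℝ | P p.1 (2 * π * p.2) = 2 * π * p.2 + 2 * π * k} :=
      isClosed_eq (hc.comp (by fun_prop : Continuous fun p : ℝ × ℝ => (p.1, 2 * π * p.2)))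
        (by fun_prop)
    have himage := (((isCompact_Icc (a := μ * k - 1 - |b|) (b := μ * k + 1 + |b|)).prod
      (isCompact_Icc (a := (0 : ℝ)) (b := 1))).inter_right hclosed).image continuous_fst
    convert himage using 1
    ext a
    constructor
    · intro ha
      obtain ⟨x, hx, h⟩ := (hiff a).1 ha
      exact ⟨(a, x), ⟨⟨(hP a).mem_Icc_of_map_eq hμ h, hx⟩, h⟩, rfl⟩
    · rintro ⟨⟨a, x⟩, ⟨⟨-, hx⟩, h⟩, rfl⟩
      exact (hiff a).2 ⟨x, hx, h⟩
  exact ⟨_, _, csInf_le_csSup hne hcompact.bddBelow hcompact.bddAbove,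
    eq_Icc_of_connected_compact ⟨hne, hconn.isPreconnected⟩ hcompact⟩
end

section
/- Let b > 0, μ > 0, k ∈ ℤ, and let [a⁻, a⁺] = { a ∈ ℝ : ρ_{a,b,μ} = k } be the corresponding section of the k-th Arnold tongue. Then the Poincaré lift fixes 0 (mod 2π) at one endpoint and π (mod 2π) at the other: either ( P̃_{a⁻,b,μ}(0) = 2πk and P̃_{a⁺,b,μ}(π) = π + 2πk ) or ( P̃_{a⁻,b,μ}(π) = π + 2πk and P̃_{a⁺,b,μ}(0) = 2πk ). -/
open Real Filter

open Set in
/-- Grönwall's estimate for the dependence of a solution on its initial value and on `a`. -/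
theorem IsJosephsonSol.dist_le {a a' b μ : ℝ} (hμ : 0 < μ) {x y : ℝ → ℝ}
    (hx : IsJosephsonSol a b μ x) (hy : IsJosephsonSol a' b μ y) (h0 : x 0 = y 0) :
    ∀ t : ℝ, 0 ≤ t → |x t - y t| ≤ gronwallBound 0 (1 / μ) (|a - a'| / μ) t := by
  intro t ht
  have key := norm_le_gronwallBound_of_norm_deriv_right_le (f := fun s => x s - y s)
    (f' := fun s => (cos (x s) + a + b * cos s) / μ - (cos (y s) + a' + b * cos s) / μ)
    (δ := 0) (K := 1 / μ) (ε := |a - a'| / μ) (a := 0) (b := t)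
    (fun s _ => ((hx s).sub (hy s)).continuousAt.continuousWithinAt)
    (fun s _ => ((hx s).sub (hy s)).hasDerivWithinAt) (by simp [h0])
    (fun s _ => by
      have e : (cos (x s) + a + b * cos s) / μ - (cos (y s) + a' + b * cos s) / μ
          = (cos (x s) - cos (y s) + (a - a')) / μ := by ring
      rw [e, norm_eq_abs, norm_eq_abs, abs_div, abs_of_pos hμ, div_mul_eq_mul_div, one_mul,
        ← add_div]
      gcongr
      exact (abs_add_le _ _).trans (add_le_add (abs_cos_sub_cos_le _ _) le_rfl))
    t (right_mem_Icc.2 ht)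
  simpa using key

theorem IsJosephsonSol.eq_of_eq {a b μ : ℝ} (hμ : 0 < μ) {x y : ℝ → ℝ}
    (hx : IsJosephsonSol a b μ x) (hy : IsJosephsonSol a b μ y) (h0 : x 0 = y 0) :
    x (2 * π) = y (2 * π) := by
  have h := hx.dist_le hμ hy h0 (2 * π) (by positivity)
  rw [sub_self, abs_zero, zero_div, gronwallBound_ε0_δ0] at h
  exact sub_eq_zero.1 (abs_nonpos_iff.1 h)

open Set in
theorem IsJosephsonSol.lt_of_lt {a a' b μ : ℝ} (hμ : 0 < μ) {x y : ℝ → ℝ}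
    (hx : IsJosephsonSol a b μ x) (hy : IsJosephsonSol a' b μ y) (ha : a < a')
    (h0 : x 0 ≤ y 0) : x (2 * π) < y (2 * π) := by
  have hle : ∀ t ∈ Icc 0 (2 * π), x t ≤ y t := fun t ht =>
    image_le_of_deriv_right_lt_deriv_boundary'
      (fun s _ => (hx s).continuousAt.continuousWithinAt) (fun s _ => (hx s).hasDerivWithinAt) h0
      (fun s _ => (hy s).continuousAt.continuousWithinAt) (fun s _ => (hy s).hasDerivWithinAt)
      (fun s _ hs => by rw [hs]; gcongr) ht
  have hd : ∀ t, HasDerivAt (fun s => exp (s / μ) * (y s - x s))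
      (exp (t / μ) * (1 / μ) * (y t - x t) + exp (t / μ) *
        ((cos (y t) + a' + b * cos t) / μ - (cos (x t) + a + b * cos t) / μ)) t := fun t =>
    (((hasDerivAt_id t).div_const μ).exp).mul ((hy t).sub (hx t))
  have hmono : StrictMonoOn (fun s => exp (s / μ) * (y s - x s)) (Icc 0 (2 * π)) := by
    refine strictMonoOn_of_deriv_pos (convex_Icc _ _)
      (fun s _ => (hd s).continuousAt.continuousWithinAt) fun t ht => ?_
    have ht' := interior_subset ht
    rw [(hd t).deriv]
    have h1 := (abs_le.1 (abs_cos_sub_cos_le (y t) (x t))).1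
    rw [abs_of_nonneg (sub_nonneg.2 (hle t ht'))] at h1
    have e : exp (t / μ) * (1 / μ) * (y t - x t) + exp (t / μ) *
        ((cos (y t) + a' + b * cos t) / μ - (cos (x t) + a + b * cos t) / μ)
        = exp (t / μ) * (((y t - x t) + (cos (y t) - cos (x t)) + (a' - a)) / μ) := by ring
    rw [e]
    have : 0 < (y t - x t) + (cos (y t) - cos (x t)) + (a' - a) := by linarith
    positivity
  have h2 := hmono (left_mem_Icc.2 (by positivity)) (right_mem_Icc.2 (by positivity))
    (show (0 : ℝ) < 2 * π by positivity)
  simp only [zero_div, exp_zero, one_mul] at h2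
  have h3 : 0 < exp (2 * π / μ) * (y (2 * π) - x (2 * π)) := by linarith
  exact sub_pos.1 (pos_of_mul_pos_right h3 (exp_pos _).le)

theorem IsJosephsonSol.add_int {a b μ : ℝ} {x : ℝ → ℝ} (hx : IsJosephsonSol a b μ x) (m : ℤ) :
    IsJosephsonSol a b μ (fun t => x t + 2 * π * m) := fun t => by
  have h : cos (x t + 2 * π * m) = cos (x t) := by
    rw [mul_comm]; exact cos_add_int_mul_two_pi _ _
  simpa only [h] using (hx t).add_const (2 * π * (m : ℝ))

theorem IsJosephsonSol.reverse {a b μ : ℝ} {x : ℝ → ℝ} (hx : IsJosephsonSol a b μ x) :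
    IsJosephsonSol a b μ (fun t => -x (2 * π - t)) := fun t => by
  have h := ((hx (2 * π - t)).comp_const_sub (2 * π) t).neg
  simp only [cos_two_pi_sub, neg_neg] at h
  simpa only [cos_neg] using! h

open Set in
/-- The cross ratio of the points `exp (i x)` is preserved along four solutions; here for
solutions starting at a harmonic quadruple. -/
theorem IsJosephsonSol.harmonic {a b μ : ℝ} {x y z w : ℝ → ℝ}
    (hx : IsJosephsonSol a b μ x) (hy : IsJosephsonSol a b μ y)
    (hz : IsJosephsonSol a b μ z) (hw : IsJosephsonSol a b μ w)
    (h0 : sin ((x 0 - z 0) / 2) * sin ((y 0 - w 0) / 2) +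
      sin ((y 0 - z 0) / 2) * sin ((x 0 - w 0) / 2) = 0) :
    ∀ t : ℝ, 0 ≤ t → sin ((x t - z t) / 2) * sin ((y t - w t) / 2) +
      sin ((y t - z t) / 2) * sin ((x t - w t) / 2) = 0 := by
  have hs : ∀ {u v : ℝ → ℝ}, IsJosephsonSol a b μ u → IsJosephsonSol a b μ v → ∀ t,
      HasDerivAt (fun s => sin ((u s - v s) / 2))
        (-(sin (u t) + sin (v t)) / (2 * μ) * sin ((u t - v t) / 2)) t := by
    intro u v hu hv t
    convert! (((hu t).sub (hv t)).div_const 2).sin using 1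
    have e1 : cos (u t) - cos (v t) = -2 * sin ((u t + v t) / 2) * sin ((u t - v t) / 2) :=
      cos_sub_cos _ _
    have e2 : sin (u t) + sin (v t) = 2 * sin ((u t + v t) / 2) * cos ((u t - v t) / 2) := by
      have h1 : u t = (u t + v t) / 2 + (u t - v t) / 2 := by ring
      have h2 : v t = (u t + v t) / 2 - (u t - v t) / 2 := by ring
      have h3 := congrArg sin h1
      have h4 := congrArg sin h2
      rw [sin_add] at h3
      rw [sin_sub] at h4
      linarith
    have e3 : (cos (u t) + a + b * cos t) / μ - (cos (v t) + a + b * cos t) / μ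
      = (cos (u t) - cos (v t)) / μ := by ring
    rw [e3, e1, e2, Pi.sub_apply]
    ring
  intro t ht
  have hd : ∀ s, HasDerivAt (fun s => sin ((x s - z s) / 2) * sin ((y s - w s) / 2) +
      sin ((y s - z s) / 2) * sin ((x s - w s) / 2))
      (-(sin (x s) + sin (y s) + sin (z s) + sin (w s)) / (2 * μ) *
        (sin ((x s - z s) / 2) * sin ((y s - w s) / 2) +
          sin ((y s - z s) / 2) * sin ((x s - w s) / 2))) s := by
    intro s
    convert! ((hs hx hz s).mul (hs hy hw s)).add ((hs hy hz s).mul (hs hx hw s)) using 1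
    ring
  refine eq_zero_of_abs_deriv_le_mul_abs_self_of_eq_zero_right (K := 4 / |2 * μ|)
    (fun s _ => (hd s).continuousAt.continuousWithinAt) (fun s _ => (hd s).hasDerivWithinAt) h0
    (fun s _ => ?_) t (right_mem_Icc.2 ht)
  rw [norm_mul, norm_eq_abs, norm_eq_abs, abs_div, abs_neg]
  gcongr
  rw [abs_le]
  constructor <;> linarith [neg_one_le_sin (x s), neg_one_le_sin (y s), neg_one_le_sin (z s),
    neg_one_le_sin (w s), sin_le_one (x s), sin_le_one (y s), sin_le_one (z s), sin_le_one (w s)]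

theorem IsPoincareLift.lt_of_lt {a a' b μ : ℝ} (hμ : 0 < μ) {P Q : ℝ → ℝ}
    (hP : IsPoincareLift a b μ P) (hQ : IsPoincareLift a' b μ Q) (ha : a < a') {u v : ℝ}
    (huv : u ≤ v) : P u < Q v := by
  obtain ⟨x, hx, x0, xe⟩ := hP u
  obtain ⟨y, hy, y0, ye⟩ := hQ v
  rw [xe, ye]
  exact hx.lt_of_lt hμ hy ha (by rwa [x0, y0])

theorem IsPoincareLift.map_add_int {a b μ : ℝ} (hμ : 0 < μ) {P : ℝ → ℝ}
    (hP : IsPoincareLift a b μ P) (u : ℝ) (m : ℤ) : P (u + 2 * π * m) = P u + 2 * π * m := by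
  obtain ⟨x, hx, x0, xe⟩ := hP u
  obtain ⟨y, hy, y0, ye⟩ := hP (u + 2 * π * m)
  rw [xe, ye]
  exact hy.eq_of_eq hμ (hx.add_int m) (by rw [x0, y0])

theorem IsPoincareLift.map_neg_map {a b μ : ℝ} (hμ : 0 < μ) {P : ℝ → ℝ}
    (hP : IsPoincareLift a b μ P) (u : ℝ) : P (-P u) = -u := by
  obtain ⟨x, hx, x0, xe⟩ := hP u
  obtain ⟨y, hy, y0, ye⟩ := hP (-P u)
  rw [ye, hy.eq_of_eq hμ hx.reverse (by simp [y0, xe])]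
  simp [x0]

/-- The Poincaré lift depends continuously on the parameter `a`. -/
theorem continuous_poincareLift_param {b μ : ℝ} (hμ : 0 < μ) {P : ℝ → ℝ → ℝ}
    (hP : ∀ a : ℝ, IsPoincareLift a b μ (P a)) (u : ℝ) : Continuous fun a => P a u := by
  rw [continuous_iff_continuousAt]
  intro a
  rw [ContinuousAt, tendsto_iff_dist_tendsto_zero]
  have hc : Continuous fun c : ℝ => gronwallBound 0 (1 / μ) (|c - a| / μ) (2 * π) :=
    (gronwallBound_continuous_ε 0 (1 / μ) (2 * π)).comp (by fun_prop)
  have hl := hc.tendsto a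
  simp only [sub_self, abs_zero, zero_div, gronwallBound_ε0_δ0] at hl
  refine squeeze_zero (fun _ => dist_nonneg) (fun c => ?_) hl
  obtain ⟨x, hx, x0, xe⟩ := hP c u
  obtain ⟨y, hy, y0, ye⟩ := hP a u
  rw [xe, ye, dist_eq]
  exact hx.dist_le hμ hy (by rw [x0, y0]) _ (by positivity)

theorem monotone_poincareLift {b μ : ℝ} (hμ : 0 < μ) {P : ℝ → ℝ → ℝ}
    (hP : ∀ a : ℝ, IsPoincareLift a b μ (P a)) (a : ℝ) : Monotone (P a) := fun _ v huv =>
  ge_of_tendsto ((continuous_poincareLift_param hμ hP v).continuousWithinAt (s := Set.Ioi a))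
    (eventually_nhdsWithin_of_forall fun _ ha' => ((hP a).lt_of_lt hμ (hP _) ha' huv).le)

theorem continuous_poincareLift {b μ : ℝ} (hμ : 0 < μ) {P : ℝ → ℝ → ℝ}
    (hP : ∀ a : ℝ, IsPoincareLift a b μ (P a)) (a : ℝ) : Continuous (P a) :=
  (monotone_poincareLift hμ hP a).continuous_of_surjective fun u =>
    ⟨-P a (-u), by rw [(hP a).map_neg_map hμ, neg_neg]⟩

theorem IsRotNumber.le_of_iterate_le {P : ℝ → ℝ} {ρ c u : ℝ} (h : IsRotNumber P ρ)
    (hP : ∀ n : ℕ, P^[n] u ≤ u + 2 * π * c * n) : ρ ≤ c := by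
  refine le_of_tendsto (h u) ((eventually_gt_atTop 0).mono fun n hn => ?_)
  have hn' : (0 : ℝ) < n := Nat.cast_pos.2 hn
  rw [div_le_iff₀ (by positivity)]
  linarith [hP n]

theorem IsRotNumber.ge_of_le_iterate {P : ℝ → ℝ} {ρ c u : ℝ} (h : IsRotNumber P ρ)
    (hP : ∀ n : ℕ, u + 2 * π * c * n ≤ P^[n] u) : c ≤ ρ := by
  refine ge_of_tendsto (h u) ((eventually_gt_atTop 0).mono fun n hn => ?_)
  have hn' : (0 : ℝ) < n := Nat.cast_pos.2 hn
  rw [le_div_iff₀ (by positivity)]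
  linarith [hP n]

theorem IsRotNumber.le_of_forall_le {P : ℝ → ℝ} {ρ c : ℝ} (h : IsRotNumber P ρ)
    (hP : ∀ u, P u ≤ u + 2 * π * c) : ρ ≤ c := by
  refine h.le_of_iterate_le (u := 0) fun n => ?_
  induction n with
  | zero => simp
  | succ n ih =>
    rw [Function.iterate_succ_apply']
    push_cast
    linarith [hP (P^[n] 0)]

theorem IsRotNumber.ge_of_forall_le {P : ℝ → ℝ} {ρ c : ℝ} (h : IsRotNumber P ρ)
    (hP : ∀ u, u + 2 * π * c ≤ P u) : c ≤ ρ := by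
  refine h.ge_of_le_iterate (u := 0) fun n => ?_
  induction n with
  | zero => simp
  | succ n ih =>
    rw [Function.iterate_succ_apply']
    push_cast
    linarith [hP (P^[n] 0)]

theorem IsRotNumber.le_int_of_map_le {P : ℝ → ℝ} {ρ u : ℝ} {k : ℤ} (h : IsRotNumber P ρ)
    (hm : Monotone P) (hadd : ∀ (u : ℝ) (m : ℤ), P (u + 2 * π * m) = P u + 2 * π * m)
    (hu : P u ≤ u + 2 * π * k) : ρ ≤ k := by
  refine h.le_of_iterate_le (u := u) fun n => ?_
  induction n with
  | zero => simp
  | succ n ih =>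
    rw [Function.iterate_succ_apply']
    have h1 := hm ih
    have h2 := hadd u (k * n)
    push_cast at h2 ⊢
    rw [mul_assoc, h2] at h1
    linarith

theorem IsRotNumber.int_le_of_le_map {P : ℝ → ℝ} {ρ u : ℝ} {k : ℤ} (h : IsRotNumber P ρ)
    (hm : Monotone P) (hadd : ∀ (u : ℝ) (m : ℤ), P (u + 2 * π * m) = P u + 2 * π * m)
    (hu : u + 2 * π * k ≤ P u) : k ≤ ρ := by
  refine h.ge_of_le_iterate (u := u) fun n => ?_
  induction n with
  | zero => simp
  | succ n ih =>
    rw [Function.iterate_succ_apply']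
    have h1 := hm ih
    have h2 := hadd u (k * n)
    push_cast at h2 ⊢
    rw [mul_assoc, h2] at h1
    linarith

theorem IsRotNumber.mono {P Q : ℝ → ℝ} {ρ σ : ℝ} (hP : IsRotNumber P ρ) (hQ : IsRotNumber Q σ)
    (hm : Monotone P) (h : P ≤ Q) : ρ ≤ σ :=
  le_of_tendsto_of_tendsto' (hP 0) (hQ 0) fun n => by
    gcongr
    exact hm.iterate_le_of_le h n 0

/-- A lift with integer rotation number whose displacement is on one side of `2πk` has a point
with displacement exactly `2πk`. -/
theorem IsRotNumber.exists_map_eq {P : ℝ → ℝ} {k : ℤ} (h : IsRotNumber P k)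
    (hc : Continuous P) (hadd : ∀ (u : ℝ) (m : ℤ), P (u + 2 * π * m) = P u + 2 * π * m)
    (hside : (∀ u, u + 2 * π * k ≤ P u) ∨ ∀ u, P u ≤ u + 2 * π * k) :
    ∃ u ∈ Set.Ico 0 (2 * π), P u = u + 2 * π * k := by
  have hred : ∀ u, ∃ v ∈ Set.Ico 0 (2 * π), P v - v = P u - u := fun u => by
    refine ⟨toIcoMod two_pi_pos 0 u, toIcoMod_mem_Ico' two_pi_pos u, ?_⟩
    have h1 := hadd (toIcoMod two_pi_pos 0 u) (toIcoDiv two_pi_pos 0 u)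
    have h2 : toIcoMod two_pi_pos 0 u + 2 * π * (toIcoDiv two_pi_pos 0 u : ℤ) = u := by
      have := toIcoMod_add_toIcoDiv_zsmul two_pi_pos 0 u
      rw [zsmul_eq_mul] at this
      linarith
    rw [h2] at h1
    linarith
  suffices ∃ u, P u = u + 2 * π * k by
    obtain ⟨u, hu⟩ := this
    obtain ⟨v, hv, hvu⟩ := hred u
    exact ⟨v, hv, by linarith⟩
  obtain ⟨u, -, hu⟩ := isCompact_Icc.exists_isMinOn (Set.nonempty_Icc.2 two_pi_pos.le)
    (f := fun v => |P v - v - 2 * π * k|) (by fun_prop)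
  have hmin : ∀ v, |P u - u - 2 * π * k| ≤ |P v - v - 2 * π * k| := fun v => by
    obtain ⟨w, hw, hwv⟩ := hred v
    rw [← hwv]
    exact hu (Set.Ico_subset_Icc_self hw)
  refine ⟨u, ?_⟩
  by_contra hne
  have hpos : 0 < |P u - u - 2 * π * k| := abs_pos.2 fun h0 => hne (by linarith)
  set ε := |P u - u - 2 * π * k| with hε
  have e : 2 * π * (ε / (2 * π)) = ε := by field_simp
  have hε' : 0 < ε / (2 * π) := by positivity
  rcases hside with hs | hs
  · have := h.ge_of_forall_le (c := k + ε / (2 * π)) fun v => by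
      have h1 := hmin v
      rw [abs_of_nonneg (by linarith [hs v])] at h1
      linarith
    linarith
  · have := h.le_of_forall_le (c := k - ε / (2 * π)) fun v => by
      have h1 := hmin v
      rw [abs_of_nonpos (a := P v - v - 2 * π * k) (by linarith [hs v])] at h1
      linarith
    linarith

/-- If `x₀` and `-x₀` are fixed modulo `2πk`, the half-displacements of `0` and `π` satisfy a
trigonometric relation. -/
theorem IsPoincareLift.half_displacement {a b μ : ℝ} {P : ℝ → ℝ} {k : ℤ}
    (hP : IsPoincareLift a b μ P) {A p q : ℝ} (h₁ : P (2 * A) = 2 * A + 2 * π * k)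
    (h₂ : P (-(2 * A)) = -(2 * A) + 2 * π * k) (hp : P 0 = 2 * p + 2 * π * k)
    (hq : P π = π + 2 * q + 2 * π * k) :
    sin A ^ 2 * (cos p * sin q) + cos A ^ 2 * (sin p * cos q) = 0 := by
  obtain ⟨x, hx, x0, xe⟩ := hP (2 * A)
  obtain ⟨y, hy, y0, ye⟩ := hP (-(2 * A))
  obtain ⟨z, hz, z0, ze⟩ := hP 0
  obtain ⟨w, hw, w0, we⟩ := hP π
  have h := hx.harmonic hy hz hw (by
    rw [x0, y0, z0, w0, show (2 * A - 0) / 2 = A by ring, show (-(2 * A) - 0) / 2 = -A by ring,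
      show (-(2 * A) - π) / 2 = -(A + π / 2) by ring, show (2 * A - π) / 2 = A - π / 2 by ring,
      sin_neg, sin_neg, sin_add_pi_div_two, sin_sub_pi_div_two]
    ring) (2 * π) two_pi_pos.le
  rw [← xe, ← ye, ← ze, ← we, h₁, h₂, hp, hq,
    show (2 * A + 2 * π * k - (2 * p + 2 * π * k)) / 2 = A - p by ring,
    show (-(2 * A) + 2 * π * k - (2 * p + 2 * π * k)) / 2 = -(A + p) by ring,
    show (-(2 * A) + 2 * π * k - (π + 2 * q + 2 * π * k)) / 2 = -(A + q + π / 2) by ring,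
    show (2 * A + 2 * π * k - (π + 2 * q + 2 * π * k)) / 2 = A - q - π / 2 by ring,
    sin_neg, sin_neg, sin_add_pi_div_two, sin_sub_pi_div_two, sin_sub, sin_add, cos_add,
    cos_sub] at h
  linarith

/-- At a one-sided parameter with a fixed point, `0` or `π` is fixed modulo `2πk`. -/
theorem IsPoincareLift.map_zero_or_map_pi {a b μ : ℝ} (hμ : 0 < μ) {P : ℝ → ℝ} {k : ℤ}
    (hP : IsPoincareLift a b μ P) (hm : Monotone P)
    (hside : (∀ u, u + 2 * π * k ≤ P u) ∨ ∀ u, P u ≤ u + 2 * π * k)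
    (hfix : ∃ u ∈ Set.Ico 0 (2 * π), P u = u + 2 * π * k) :
    P 0 = 2 * π * k ∨ P π = π + 2 * π * k := by
  have hadd := hP.map_add_int hμ
  have hneg : ∀ u, P u = u + 2 * π * k → P (-u) = -u + 2 * π * k := fun u hu => by
    have h1 := hP.map_neg_map hμ u
    have h2 := hadd (-P u) k
    rw [h1, hu, show -(u + 2 * π * k) + 2 * π * k = -u by ring] at h2
    exact h2
  obtain ⟨A, hA0, hAπ, hA⟩ : ∃ A, 0 ≤ A ∧ A ≤ π / 2 ∧ P (2 * A) = 2 * A + 2 * π * k := by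
    obtain ⟨u, ⟨hu0, hu1⟩, hu⟩ := hfix
    rcases le_total u π with h | h
    · exact ⟨u / 2, by linarith, by linarith, by
        rw [mul_div_cancel₀ _ (two_ne_zero' ℝ)]; exact hu⟩
    · refine ⟨π - u / 2, by linarith, by linarith, ?_⟩
      have h1 := hadd (-u) 1
      rw [hneg u hu, Int.cast_one] at h1
      rw [show 2 * (π - u / 2) = -u + 2 * π * 1 by ring, h1]
      ring
  rcases hA0.eq_or_lt with rfl | hA0
  · left; simpa using hA
  rcases hAπ.eq_or_lt with rfl | hAπ
  · right; rwa [mul_div_cancel₀ _ (two_ne_zero' ℝ)] at hA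
  have hA' := hneg _ hA
  have hA'' := hadd (-(2 * A)) 1
  rw [hA', Int.cast_one] at hA''
  have b1 := hm (show -(2 * A) ≤ 0 by linarith)
  have b2 := hm (show 0 ≤ 2 * A by linarith)
  have b3 := hm (show 2 * A ≤ π by linarith)
  have b4 := hm (show π ≤ -(2 * A) + 2 * π * 1 by linarith)
  obtain ⟨p, hp⟩ : ∃ p, P 0 = 2 * p + 2 * π * k := ⟨(P 0 - 2 * π * k) / 2, by ring⟩
  obtain ⟨q, hq⟩ : ∃ q, P π = π + 2 * q + 2 * π * k := ⟨(P π - π - 2 * π * k) / 2, by ring⟩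
  have h := hP.half_displacement hA hA' hp hq
  have hsA : 0 < sin A ^ 2 := pow_pos (sin_pos_of_pos_of_lt_pi hA0 (by linarith)) 2
  have hcA : 0 < cos A ^ 2 := pow_pos (cos_pos_of_mem_Ioo ⟨by linarith, by linarith⟩) 2
  have hcp : 0 < cos p := cos_pos_of_mem_Ioo ⟨by linarith, by linarith⟩
  have hcq : 0 < cos q := cos_pos_of_mem_Ioo ⟨by linarith, by linarith⟩
  left
  suffices p = 0 by rw [hp, this]; ring
  rcases hside with hs | hs
  · have s1 := hs 0
    have s2 := hs π
    have : 0 ≤ sin q := sin_nonneg_of_nonneg_of_le_pi (by linarith) (by linarith)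
    by_contra hne
    have : 0 < sin p := sin_pos_of_pos_of_lt_pi
      (lt_of_le_of_ne (by linarith) (Ne.symm hne)) (by linarith)
    have : 0 < sin A ^ 2 * (cos p * sin q) + cos A ^ 2 * (sin p * cos q) := by positivity
    linarith
  · have s1 := hs 0
    have s2 := hs π
    have : 0 ≤ -sin q := neg_nonneg.2
      (sin_nonpos_of_nonpos_of_neg_pi_le (by linarith) (by linarith))
    by_contra hne
    have : 0 < -sin p := neg_pos.2 (sin_neg_of_neg_of_neg_pi_lt
      (lt_of_le_of_ne (by linarith) hne) (by linarith))
    have : 0 < sin A ^ 2 * (cos p * -sin q) + cos A ^ 2 * (-sin p * cos q) := by positivity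
    linarith

/-- On the endpoints of a section `[a⁻, a⁺]` of the `k`-th Arnold
tongue, the Poincaré lift fixes `0 (mod 2π)` at one endpoint and `π (mod 2π)` at the
other. -/
theorem tongue_boundary_fixed_points
    (b μ : ℝ) (hb : 0 < b) (hμ : 0 < μ) (k : ℤ)
    (P : ℝ → ℝ → ℝ) (ρ : ℝ → ℝ)
    (hP : ∀ a : ℝ, IsPoincareLift a b μ (P a))
    (hρ : ∀ a : ℝ, IsRotNumber (P a) (ρ a))
    (aminus aplus : ℝ) (hle : aminus ≤ aplus)
    (hE : {a : ℝ | ρ a = (k : ℝ)} = Set.Icc aminus aplus) :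
    (P aminus 0 = 2 * π * k ∧ P aplus π = π + 2 * π * k) ∨
    (P aminus π = π + 2 * π * k ∧ P aplus 0 = 2 * π * k) := by
  have hm := monotone_poincareLift hμ hP
  have hc := continuous_poincareLift hμ hP
  have hadd := fun a => (hP a).map_add_int hμ
  have hmem : ∀ a, ρ a = k ↔ aminus ≤ a ∧ a ≤ aplus := fun a => by
    rw [← Set.mem_Icc, ← hE, Set.mem_ofPred_eq]
  have hρm := (hmem aminus).2 ⟨le_rfl, hle⟩
  have hρp := (hmem aplus).2 ⟨hle, le_rfl⟩
  have hup : ∀ u, u + 2 * π * k ≤ P aplus u := fun u =>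
    ge_of_tendsto ((continuous_poincareLift_param hμ hP u).continuousWithinAt
      (s := Set.Ioi aplus)) (eventually_nhdsWithin_of_forall fun a (ha : aplus < a) => by
        by_contra! hlt
        have h1 := (hρ a).le_int_of_map_le (hm a) (hadd a) hlt.le
        have h2 := (hρ aplus).mono (hρ a) (hm aplus)
          fun v => ((hP aplus).lt_of_lt hμ (hP a) ha le_rfl).le
        exact ha.not_ge ((hmem a).1 (le_antisymm h1 (hρp ▸ h2))).2)
  have hdown : ∀ u, P aminus u ≤ u + 2 * π * k := fun u =>
    le_of_tendsto ((continuous_poincareLift_param hμ hP u).continuousWithinAt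
      (s := Set.Iio aminus)) (eventually_nhdsWithin_of_forall fun a (ha : a < aminus) => by
        by_contra! hlt
        have h1 := (hρ a).int_le_of_le_map (hm a) (hadd a) hlt.le
        have h2 := (hρ a).mono (hρ aminus) (hm a)
          fun v => ((hP a).lt_of_lt hμ (hP aminus) ha le_rfl).le
        exact ha.not_ge ((hmem a).1 (le_antisymm (hρm ▸ h2) h1)).1)
  rcases hle.eq_or_lt with rfl | hlt
  · left
    have h := fun u => le_antisymm (hdown u) (hup u)
    exact ⟨by simpa using h 0, h π⟩
  have h1 := (hP aminus).map_zero_or_map_pi hμ (hm _) (Or.inr hdown)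
    ((hρm ▸ hρ aminus).exists_map_eq (hc _) (hadd _) (Or.inr hdown))
  have h2 := (hP aplus).map_zero_or_map_pi hμ (hm _) (Or.inl hup)
    ((hρp ▸ hρ aplus).exists_map_eq (hc _) (hadd _) (Or.inl hup))
  have h3 := (hP aminus).lt_of_lt hμ (hP aplus) hlt (le_refl 0)
  have h4 := (hP aminus).lt_of_lt hμ (hP aplus) hlt (le_refl π)
  rcases h1 with h1 | h1 <;> rcases h2 with h2 | h2
  · linarith
  · exact Or.inl ⟨h1, h2⟩
  · exact Or.inr ⟨h1, h2⟩
  · linarith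
end

section
/- For the Josephson equation with b = 0, the rotation number is given explicitly by: ρ_{a,0,μ} = 0 if |a| ≤ 1, and ρ_{a,0,μ} = sgn(a)·√(a² − 1)/μ if |a| > 1. Consequently, for k ∈ ℤ, k ≠ 0, the set { a ∈ ℝ : ρ_{a,0,μ} = k } is the single point { sgn(k)·√(k²μ² + 1) }, while { a ∈ ℝ : ρ_{a,0,μ} = 0 } is the segment [−1, 1]. -/
open Real Filter

/-- A function which differs from the identity by a bounded amount and is translated by `c` under `P`
determines the rotation number of `P`. -/
theorem IsRotNumber.eq_of_translated {P G : ℝ → ℝ} {ρ c C : ℝ} (h : IsRotNumber P ρ)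
    (hG : ∀ x, |G x - x| ≤ C) (hP : ∀ x, G (P x) = G x + c) : ρ = c / (2 * π) := by
  have hiter : ∀ n : ℕ, G (P^[n] 0) = G 0 + n * c := by
    intro n
    induction n with
    | zero => simp
    | succ n ih =>
      rw [Function.iterate_succ_apply', hP, ih]
      push_cast
      ring
  refine tendsto_nhds_unique (h 0) ?_
  rw [tendsto_iff_norm_sub_tendsto_zero]
  have hlim : Tendsto (fun n : ℕ => 2 * C / (2 * π) * ((n : ℝ))⁻¹) atTop (nhds 0) := by
    simpa using (tendsto_inv_atTop_nhds_zero_nat (𝕜 := ℝ)).const_mul (2 * C / (2 * π))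
  refine squeeze_zero' (Eventually.of_forall fun _ => norm_nonneg _) ?_ hlim
  filter_upwards [eventually_gt_atTop 0] with n hn
  have hn' : (0 : ℝ) < n := by exact_mod_cast hn
  have hπ := Real.pi_pos
  have hrw : (P^[n] 0 - 0) / (2 * π * n) - c / (2 * π)
      = ((G 0 - 0) - (G (P^[n] 0) - P^[n] 0)) / (2 * π * n) := by
    rw [hiter n]
    field_simp
    ring
  have hrw' : 2 * C / (2 * π) * ((n : ℝ))⁻¹ = 2 * C / (2 * π * n) := by
    field_simp
  rw [hrw, hrw', Real.norm_eq_abs, abs_div, abs_of_pos (by positivity : 0 < 2 * π * (n : ℝ))]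
  gcongr
  calc |(G 0 - 0) - (G (P^[n] 0) - P^[n] 0)|
      ≤ |G 0 - 0| + |G (P^[n] 0) - P^[n] 0| := abs_sub _ _
    _ ≤ 2 * C := by linarith [hG 0, hG (P^[n] 0)]

/-- The phase function straightening the flow of `x' = (cos x + a) / μ`
when `σ ^ 2 = a ^ 2 - 1`. -/
noncomputable def josephsonPhase (a σ x : ℝ) : ℝ :=
  x - 2 * Real.arctan (Real.sin x / (a + σ + Real.cos x))

theorem abs_josephsonPhase_sub_le (a σ x : ℝ) : |josephsonPhase a σ x - x| ≤ π := by
  have h₁ := Real.neg_pi_div_two_lt_arctan (Real.sin x / (a + σ + Real.cos x))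
  have h₂ := Real.arctan_lt_pi_div_two (Real.sin x / (a + σ + Real.cos x))
  unfold josephsonPhase
  rw [abs_le]
  constructor <;> linarith

theorem hasDerivAt_josephsonPhase {a σ x : ℝ} (hσ : σ ^ 2 = a ^ 2 - 1) (hk : a + σ ≠ 0)
    (h₁ : a + Real.cos x ≠ 0) (h₂ : a + σ + Real.cos x ≠ 0) :
    HasDerivAt (josephsonPhase a σ) (σ / (a + Real.cos x)) x := by
  have hd := (hasDerivAt_id x).sub
    ((((Real.hasDerivAt_sin x).div ((Real.hasDerivAt_cos x).const_add (a + σ)) h₂).arctan).const_mul 2)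
  refine hd.congr_deriv ?_
  have hs := Real.sin_sq_add_cos_sq x
  have hden : (a + σ + Real.cos x) ^ 2 + Real.sin x ^ 2
      = 2 * (a + σ) * (a + Real.cos x) := by linear_combination hs + hσ
  have hone : 1 + (Real.sin x / (a + σ + Real.cos x)) ^ 2
      = 2 * (a + σ) * (a + Real.cos x) / (a + σ + Real.cos x) ^ 2 := by
    rw [← hden]
    field_simp
  have hnum : Real.cos x * (a + σ + Real.cos x) - Real.sin x * -Real.sin x
      = (a + σ) * Real.cos x + 1 := by linear_combination hs
  simp only [Pi.div_apply]
  rw [hone, hnum]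
  field_simp
  linear_combination -hσ

/-- The rotation number when `σ` is the square root of `a ^ 2 - 1` having the sign of `a`. -/
theorem josephson_rotNumber_of_sq_eq {a σ μ ρ : ℝ} {P : ℝ → ℝ} (hμ : 0 < μ) (ha : 1 < |a|)
    (hσ : σ ^ 2 = a ^ 2 - 1) (haσ : 0 ≤ a * σ) (hP : IsPoincareLift a 0 μ P)
    (hρ : IsRotNumber P ρ) : ρ = σ / μ := by
  have hne : ∀ b : ℝ, 1 < |b| → ∀ x, b + Real.cos x ≠ 0 := by
    intro b hb x h
    have hb' : b = -Real.cos x := by linarith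
    rw [hb', abs_neg] at hb
    exact absurd (Real.abs_cos_le_one x) (not_le.mpr hb)
  have ha2 : 1 < a ^ 2 := (one_lt_sq_iff_one_lt_abs a).mpr ha
  have hk : 1 < |a + σ| := by
    rw [← one_lt_sq_iff_one_lt_abs]
    nlinarith
  have hk0 : a + σ ≠ 0 := by
    intro h
    rw [h, abs_zero] at hk
    linarith
  have hstep : ∀ x₀, josephsonPhase a σ (P x₀) = josephsonPhase a σ x₀ + σ / μ * (2 * π) := by
    intro x₀
    obtain ⟨x, hx, rfl, hPx⟩ := hP x₀
    rw [hPx]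
    have hd : ∀ t, HasDerivAt (fun t => josephsonPhase a σ (x t) - σ / μ * t) 0 t := by
      intro t
      have h := ((hasDerivAt_josephsonPhase hσ hk0 (hne a ha (x t)) (hne _ hk (x t))).comp t
        (hx t)).sub ((hasDerivAt_id t).const_mul (σ / μ))
      refine h.congr_deriv ?_
      have := hne a ha (x t)
      field_simp
      ring
    have := is_const_of_deriv_eq_zero (fun t => (hd t).differentiableAt)
      (fun t => (hd t).deriv) (2 * π) 0
    linarith
  rw [hρ.eq_of_translated (abs_josephsonPhase_sub_le a σ) hstep]
  have := Real.pi_ne_zero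
  field_simp

/-- A solution starting at a zero of `cos x + a` is constant. -/
theorem IsJosephsonSol.eq_of_equilibrium {a μ : ℝ} (hμ : 0 < μ) {x : ℝ → ℝ}
    (hx : IsJosephsonSol a 0 μ x) (h0 : Real.cos (x 0) + a = 0) (t : ℝ) : x t = x 0 := by
  have hlip : LipschitzWith (Real.toNNReal μ⁻¹) (fun y : ℝ => (Real.cos y + a) / μ) := by
    refine LipschitzWith.of_dist_le_mul fun y z => ?_
    have hc := Real.lipschitzWith_cos.dist_le_mul y z
    rw [Real.dist_eq, Real.dist_eq, NNReal.coe_one, one_mul] at hc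
    rw [Real.dist_eq, Real.dist_eq, Real.coe_toNNReal _ (by positivity),
      show (Real.cos y + a) / μ - (Real.cos z + a) / μ = μ⁻¹ * (Real.cos y - Real.cos z) by ring,
      abs_mul, abs_of_pos (inv_pos.mpr hμ)]
    exact mul_le_mul_of_nonneg_left hc (by positivity)
  have hEq := ODE_solution_unique_univ (v := fun _ y => (Real.cos y + a) / μ)
    (s := fun _ => Set.univ) (f := x) (g := fun _ => x 0) (t₀ := 0)
    (fun _ => hlip.lipschitzOnWith)
    (fun t => ⟨by simpa using hx t, Set.mem_univ _⟩)
    (fun t => ⟨by simpa [h0] using hasDerivAt_const t (x 0), Set.mem_univ _⟩) rfl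
  exact congrFun hEq t

theorem josephson_rotNumber_of_abs_le_one {a μ ρ : ℝ} {P : ℝ → ℝ} (hμ : 0 < μ) (ha : |a| ≤ 1)
    (hP : IsPoincareLift a 0 μ P) (hρ : IsRotNumber P ρ) : ρ = 0 := by
  obtain ⟨h₁, h₂⟩ := abs_le.mp ha
  obtain ⟨x, hx, hx0, hPx⟩ := hP (Real.arccos (-a))
  have h0 : Real.cos (x 0) + a = 0 := by
    rw [hx0, Real.cos_arccos (by linarith) (by linarith)]
    ring
  have hfix : Function.IsFixedPt P (Real.arccos (-a)) := by
    rw [Function.IsFixedPt, hPx, hx.eq_of_equilibrium hμ h0, hx0]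
  have := hρ (Real.arccos (-a))
  simp only [(hfix.iterate _).eq, sub_self, zero_div] at this
  exact tendsto_nhds_unique this tendsto_const_nhds

/-- Explicit rotation number of the Josephson equation for `b = 0`:
`ρ_{a,0,μ} = 0` for `|a| ≤ 1` and `ρ_{a,0,μ} = sgn(a)·√(a² - 1)/μ` for `|a| > 1`;
consequently `{a : ρ = k}` is the point `sgn(k)·√(k²μ² + 1)` for `k ≠ 0`, and the
segment `[-1, 1]` for `k = 0`. -/
theorem rotation_number_b_zero
    (μ : ℝ) (hμ : 0 < μ) (P : ℝ → ℝ → ℝ) (ρ : ℝ → ℝ)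
    (hP : ∀ a : ℝ, IsPoincareLift a 0 μ (P a))
    (hρ : ∀ a : ℝ, IsRotNumber (P a) (ρ a)) :
    (∀ a : ℝ, |a| ≤ 1 → ρ a = 0) ∧
    (∀ a : ℝ, 1 < |a| → ρ a = Real.sign a * Real.sqrt (a ^ 2 - 1) / μ) ∧
    (∀ k : ℤ, k ≠ 0 →
      {a : ℝ | ρ a = (k : ℝ)}
        = {Real.sign (k : ℝ) * Real.sqrt ((k : ℝ) ^ 2 * μ ^ 2 + 1)}) ∧
    {a : ℝ | ρ a = 0} = Set.Icc (-1 : ℝ) 1 := by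
  have hle : ∀ a : ℝ, |a| ≤ 1 → ρ a = 0 := fun a ha =>
    josephson_rotNumber_of_abs_le_one hμ ha (hP a) (hρ a)
  have hgt : ∀ a : ℝ, 1 < |a| → ρ a = Real.sign a * Real.sqrt (a ^ 2 - 1) / μ := by
    intro a ha
    have ha2 : 1 < a ^ 2 := (one_lt_sq_iff_one_lt_abs a).mpr ha
    have hsq := Real.sq_sqrt (by linarith : 0 ≤ a ^ 2 - 1)
    have hnn := Real.sqrt_nonneg (a ^ 2 - 1)
    refine josephson_rotNumber_of_sq_eq hμ ha ?_ ?_ (hP a) (hρ a) <;>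
      rcases lt_trichotomy a 0 with h | h | h
    · rw [Real.sign_of_neg h]; linarith
    · norm_num [h] at ha
    · rw [Real.sign_of_pos h]; linarith
    · rw [Real.sign_of_neg h]; nlinarith
    · simp [h]
    · rw [Real.sign_of_pos h]; nlinarith
  refine ⟨hle, hgt, ?_, ?_⟩
  · intro k hk
    have hkR : (k : ℝ) ≠ 0 := by exact_mod_cast hk
    ext a
    simp only [Set.mem_ofPred_eq, Set.mem_singleton_iff]
    constructor
    · intro h
      have ha : 1 < |a| := by
        by_contra! hc
        exact hkR (by rw [← h, hle a hc])
      have ha2 : 1 < a ^ 2 := (one_lt_sq_iff_one_lt_abs a).mpr ha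
      have hpos : 0 < Real.sqrt (a ^ 2 - 1) := Real.sqrt_pos.mpr (by linarith)
      have hsq := Real.sq_sqrt (by linarith : 0 ≤ a ^ 2 - 1)
      rw [hgt a ha] at h
      rcases lt_trichotomy a 0 with h' | h' | h'
      · rw [Real.sign_of_neg h'] at h
        have hkneg : (k : ℝ) < 0 := by
          rw [← h]
          exact div_neg_of_neg_of_pos (by linarith) hμ
        rw [div_eq_iff hμ.ne'] at h
        rw [Real.sign_of_neg hkneg, ← mul_pow, ← h,
          show (-1 * Real.sqrt (a ^ 2 - 1)) ^ 2 + 1 = a ^ 2 by linarith, Real.sqrt_sq_eq_abs,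
          abs_of_neg h']
        ring
      · norm_num [h'] at ha
      · rw [Real.sign_of_pos h'] at h
        have hkpos : 0 < (k : ℝ) := by
          rw [← h]
          positivity
        rw [div_eq_iff hμ.ne'] at h
        rw [Real.sign_of_pos hkpos, ← mul_pow, ← h,
          show (1 * Real.sqrt (a ^ 2 - 1)) ^ 2 + 1 = a ^ 2 by linarith, Real.sqrt_sq_eq_abs,
          abs_of_pos h']
        ring
    · have hkμ : 0 < (k : ℝ) ^ 2 * μ ^ 2 := by positivity
      have hsq := Real.sq_sqrt (by linarith : 0 ≤ (k : ℝ) ^ 2 * μ ^ 2 + 1)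
      have hpos : 0 < Real.sqrt ((k : ℝ) ^ 2 * μ ^ 2 + 1) := Real.sqrt_pos.mpr (by linarith)
      intro h
      rcases hkR.lt_or_gt with h' | h'
      · rw [Real.sign_of_neg h'] at h
        have ha2 : a ^ 2 = ((k : ℝ) * μ) ^ 2 + 1 := by rw [h]; linarith
        rw [hgt a ((one_lt_sq_iff_one_lt_abs a).mp (by linarith)),
          Real.sign_of_neg (by linarith), ha2, add_sub_cancel_right, Real.sqrt_sq_eq_abs,
          abs_of_neg (mul_neg_of_neg_of_pos h' hμ)]
        field_simp
      · rw [Real.sign_of_pos h'] at h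
        have ha2 : a ^ 2 = ((k : ℝ) * μ) ^ 2 + 1 := by rw [h]; linarith
        rw [hgt a ((one_lt_sq_iff_one_lt_abs a).mp (by linarith)),
          Real.sign_of_pos (by linarith), ha2, add_sub_cancel_right, Real.sqrt_sq_eq_abs,
          abs_of_pos (mul_pos h' hμ)]
        field_simp
  · ext a
    rw [Set.mem_ofPred_eq, Set.mem_Icc, ← abs_le]
    refine ⟨fun h => ?_, hle a⟩
    by_contra! ha
    have ha2 : 1 < a ^ 2 := (one_lt_sq_iff_one_lt_abs a).mpr ha
    have hpos : 0 < Real.sqrt (a ^ 2 - 1) := Real.sqrt_pos.mpr (by linarith)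
    have ha0 : a ≠ 0 := by rintro rfl; norm_num at ha
    rw [hgt a ha] at h
    exact div_ne_zero (mul_ne_zero (Real.sign_eq_zero_iff.not.mpr ha0) hpos.ne') hμ.ne' h
end
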